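/- For every k ≥ 1 and every g ≥ 4, the plane digraph G_k (defined in the context) has digirth g, order n_k = k(g−1)+1, and minimum feedback vertex set size fvs(G_k) = k = (n_k − 1)/(g − 1). -/

import Mathlib

/-- A finite directed graph. -/
structure Digr where
  V : Type
  [fintypeV : Fintype V]
  [decEqV : DecidableEq V]
  Adj : V → V → Prop

attribute [instance] Digr.fintypeV Digr.decEqV

/-- `l` is (the list of vertices of) a directed cycle in the digraph `H`. -/
def Digr.IsDicycle (H : Digr) (l : List H.V) : Prop :=
  l ≠ [] ∧ l.Nodup ∧
    ∀ i : Fin l.length,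
      H.Adj (l.get i)
        (l.get ⟨(i.1 + 1) % l.length, Nat.mod_lt _ (Nat.lt_of_le_of_lt (Nat.zero_le _) i.isLt)⟩)

/-- A feedback vertex set: a set of vertices meeting every directed cycle. -/
def Digr.IsFVS (H : Digr) (S : Finset H.V) : Prop :=
  ∀ l : List H.V, H.IsDicycle l → ∃ x ∈ S, x ∈ l

/-- The minimum size of a feedback vertex set of `H`. -/
noncomputable def Digr.fvs (H : Digr) : ℕ :=
  sInf {n | ∃ S : Finset H.V, H.IsFVS S ∧ S.card = n}

/-- `H` has digirth `g`: the minimum length of a directed cycle of `H` is `g`. -/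
def Digr.HasDigirth (H : Digr) (g : ℕ) : Prop :=
  (∃ l, H.IsDicycle l ∧ l.length = g) ∧ ∀ l, H.IsDicycle l → g ≤ l.length
/-- The canonical vertex of the frieze digraph representing the vertex
`v^{i+1}_j` (indices `i < k`, `j < g` taken modulo); the vertex `v^{i+1}_{g-1}`
is identified with `v^i_1` for `i ≥ 1`, and `v^1_{g-1}` is the extra vertex
`none`. -/
def frV (k g : ℕ) (hk : 0 < k) (hg : 4 ≤ g) (i j : ℕ) :
    Option (Fin k × Fin (g - 1)) :=
  if _h : j % g = g - 1 then
    if i = 0 then none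
    else some (⟨(i - 1) % k, Nat.mod_lt _ hk⟩, ⟨1, by omega⟩)
  else some (⟨i % k, Nat.mod_lt _ hk⟩, ⟨j % g, by
    have h2 : j % g < g := Nat.mod_lt _ (by omega)
    omega⟩)

/-- The frieze digraph `G_k` of digirth `g`: the union of `k` directed `g`-cycles
`C^{(1)}, …, C^{(k)}`, where for each `i` the vertex `v^{i+1}_{g-1}` of
`C^{(i+1)}` is identified with the vertex `v^i_1` of `C^{(i)}` (a link vertex),
together with the link arcs `v^i_0 → v^{i+1}_0` and `v^{i+1}_{g-2} → v^i_2`. -/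
def frieze (k g : ℕ) (hk : 0 < k) (hg : 4 ≤ g) : Digr where
  V := Option (Fin k × Fin (g - 1))
  Adj x y := ∃ i j : ℕ, i < k ∧ j < g ∧
    ((x = frV k g hk hg i j ∧ y = frV k g hk hg i ((j + 1) % g)) ∨
     (i + 1 < k ∧ j = 0 ∧ x = frV k g hk hg i 0 ∧ y = frV k g hk hg (i + 1) 0) ∨
     (i + 1 < k ∧ x = frV k g hk hg (i + 1) (g - 2) ∧ y = frV k g hk hg i 2))

/-- Level of a vertex (`none` has level `0`). -/
def frLvl {k n : ℕ} : Option (Fin k × Fin n) → ℕ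
  | none => 0
  | some (i, _) => i.1 + 1

/-- Column of a vertex (`none` has column `1`). -/
def frCol {k n : ℕ} : Option (Fin k × Fin n) → ℕ
  | none => 1
  | some (_, j) => j.1

theorem fr_ext {k n : ℕ} (x y : Option (Fin k × Fin n)) :
    x = y ↔ frLvl x = frLvl y ∧ frCol x = frCol y := by
  constructor
  · rintro rfl; exact ⟨rfl, rfl⟩
  · rcases x with _ | ⟨i, j⟩ <;> rcases y with _ | ⟨i', j'⟩ <;>
      simp [frLvl, frCol, Fin.ext_iff]

theorem fr_bounds {k n : ℕ} (x : Option (Fin k × Fin n)) :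
    (frLvl x = 0 ∧ frCol x = 1) ∨ (1 ≤ frLvl x ∧ frLvl x ≤ k ∧ frCol x < n) := by
  rcases x with _ | ⟨i, j⟩
  · left; exact ⟨rfl, rfl⟩
  · right; simp only [frLvl, frCol]; omega

theorem fr_exists {k n p q : ℕ} (h : (p = 0 ∧ q = 1) ∨ (1 ≤ p ∧ p ≤ k ∧ q < n)) :
    ∃ x : Option (Fin k × Fin n), frLvl x = p ∧ frCol x = q := by
  rcases h with ⟨rfl, rfl⟩ | ⟨h1, h2, h3⟩
  · exact ⟨none, rfl, rfl⟩
  · exact ⟨some (⟨p - 1, by omega⟩, ⟨q, h3⟩), by simp only [frLvl]; omega, rfl⟩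

theorem frV_lvl_col (k g : ℕ) (hk : 0 < k) (hg : 4 ≤ g) (i j : ℕ) (hi : i < k) (hj : j < g) :
    (j = g - 1 ∧ frLvl (frV k g hk hg i j) = i ∧ frCol (frV k g hk hg i j) = 1) ∨
    (j < g - 1 ∧ frLvl (frV k g hk hg i j) = i + 1 ∧ frCol (frV k g hk hg i j) = j) := by
  unfold frV
  have hjm := Nat.mod_eq_of_lt hj
  by_cases h : j % g = g - 1
  · left
    refine ⟨by omega, ?_⟩
    rw [dif_pos h]
    by_cases h0 : i = 0
    · rw [if_pos h0]; exact ⟨h0.symm, rfl⟩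
    · rw [if_neg h0]
      refine ⟨?_, rfl⟩
      change (i - 1) % k + 1 = i
      rw [Nat.mod_eq_of_lt (by omega)]
      omega
  · right
    rw [dif_neg h]
    simp only [frLvl, frCol]
    rw [Nat.mod_eq_of_lt hi]
    omega

/-- Numeric description of the arcs. -/
def FrR (k g p q p' q' : ℕ) : Prop :=
  (1 ≤ p ∧ p ≤ k ∧ p' = p ∧ q' = q + 1 ∧ q + 1 < g - 1) ∨
  (1 ≤ p ∧ p ≤ k ∧ p' + 1 = p ∧ q = g - 2 ∧ q' = 1) ∨
  (p' = p + 1 ∧ q = 1 ∧ q' = 0 ∧ p < k) ∨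
  (1 ≤ p ∧ p' = p + 1 ∧ p < k ∧ q = 0 ∧ q' = 0) ∨
  (1 ≤ p' ∧ p = p' + 1 ∧ p ≤ k ∧ q = g - 2 ∧ q' = 2)

theorem fr_adj (k g : ℕ) (hk : 0 < k) (hg : 4 ≤ g) (x y : Option (Fin k × Fin (g - 1))) :
    (frieze k g hk hg).Adj x y ↔ FrR k g (frLvl x) (frCol x) (frLvl y) (frCol y) := by
  have key := frV_lvl_col k g hk hg
  constructor
  · rintro ⟨i, j, hi, hj, h⟩
    simp only [fr_ext] at h
    unfold FrR
    rcases h with ⟨h1, h2⟩ | ⟨h0, h1, h2, h3⟩ | ⟨h0, h2, h3⟩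
    · have a := key i j hi hj
      rcases Nat.lt_or_ge (j + 1) g with hj' | hj'
      · rw [Nat.mod_eq_of_lt hj'] at h2
        have b := key i (j + 1) hi hj'
        rcases a with a | a
        · omega
        · rcases b with b | b
          · exact Or.inr (Or.inl (by omega))
          · exact Or.inl (by omega)
      · have e : j + 1 = g := by omega
        rw [e, Nat.mod_self] at h2
        have b := key i 0 hi (by omega)
        exact Or.inr (Or.inr (Or.inl (by omega)))
    · have a := key i 0 hi (by omega)
      have b := key (i + 1) 0 h0 (by omega)
      exact Or.inr (Or.inr (Or.inr (Or.inl (by omega))))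
    · have a := key (i + 1) (g - 2) h0 (by omega)
      have b := key i 2 hi (by omega)
      exact Or.inr (Or.inr (Or.inr (Or.inr (by omega))))
  · intro h
    rcases h with h | h | h | h | h
    · refine ⟨frLvl x - 1, frCol x, by omega, by omega, Or.inl ?_⟩
      rw [Nat.mod_eq_of_lt (by omega), fr_ext, fr_ext]
      have a := key (frLvl x - 1) (frCol x) (by omega) (by omega)
      have b := key (frLvl x - 1) (frCol x + 1) (by omega) (by omega)
      omega
    · refine ⟨frLvl x - 1, g - 2, by omega, by omega, Or.inl ?_⟩
      rw [Nat.mod_eq_of_lt (by omega), fr_ext, fr_ext]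
      have a := key (frLvl x - 1) (g - 2) (by omega) (by omega)
      have b := key (frLvl x - 1) (g - 2 + 1) (by omega) (by omega)
      omega
    · refine ⟨frLvl x, g - 1, by omega, by omega, Or.inl ?_⟩
      have e : g - 1 + 1 = g := by omega
      rw [e, Nat.mod_self, fr_ext, fr_ext]
      have a := key (frLvl x) (g - 1) (by omega) (by omega)
      have b := key (frLvl x) 0 (by omega) (by omega)
      omega
    · refine ⟨frLvl x - 1, 0, by omega, by omega, Or.inr (Or.inl ?_)⟩
      rw [fr_ext, fr_ext]
      have a := key (frLvl x - 1) 0 (by omega) (by omega)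
      have b := key (frLvl x - 1 + 1) 0 (by omega) (by omega)
      omega
    · refine ⟨frLvl y - 1, 0, by omega, by omega, Or.inr (Or.inr ?_)⟩
      rw [fr_ext, fr_ext]
      have a := key (frLvl y - 1) 2 (by omega) (by omega)
      have b := key (frLvl y - 1 + 1) (g - 2) (by omega) (by omega)
      omega

theorem dicycle_succ (H : Digr) (l : List H.V) (hl : H.IsDicycle l) (x : H.V) (hx : x ∈ l) :
    ∃ y ∈ l, H.Adj x y := by
  obtain ⟨i, rfl⟩ := List.get_of_mem hx
  exact ⟨_, List.get_mem _ _, hl.2.2 i⟩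

theorem dicycle_pred (H : Digr) (l : List H.V) (hl : H.IsDicycle l) (x : H.V) (hx : x ∈ l) :
    ∃ y ∈ l, H.Adj y x := by
  obtain ⟨⟨i, hi⟩, rfl⟩ := List.get_of_mem hx
  rcases Nat.eq_zero_or_pos i with rfl | h0
  · have h := hl.2.2 ⟨l.length - 1, by omega⟩
    refine ⟨l.get ⟨l.length - 1, by omega⟩, List.get_mem _ _, ?_⟩
    · convert h using 2
      apply Fin.ext
      simp only
      rw [Nat.sub_add_cancel (by omega), Nat.mod_self]
  · have h := hl.2.2 ⟨i - 1, by omega⟩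
    refine ⟨l.get ⟨i - 1, by omega⟩, List.get_mem _ _, ?_⟩
    · convert h using 2
      apply Fin.ext
      simp only
      rw [Nat.sub_add_cancel (by omega), Nat.mod_eq_of_lt hi]

/-- A nonempty vertex set in which each vertex has an out-neighbour contains a dicycle. -/
theorem exists_dicycle (H : Digr) (P : H.V → Prop) (x0 : H.V) (h0 : P x0)
    (h : ∀ x, P x → ∃ y, P y ∧ H.Adj x y) : ∃ l, H.IsDicycle l ∧ ∀ x ∈ l, P x := by
  classical
  choose! f hfP hfA using h
  have hit : ∀ n, P (f^[n] x0) := by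
    intro n
    induction n with
    | zero => exact h0
    | succ n ih => rw [Function.iterate_succ_apply']; exact hfP _ ih
  obtain ⟨a, b, hab, he⟩ := Finite.exists_ne_map_eq_of_infinite (fun n : ℕ => f^[n] x0)
  wlog hlt : a < b generalizing a b
  · exact this b a hab.symm he.symm (by omega)
  set z := f^[a] x0 with hz
  have hper : Function.IsPeriodicPt f (b - a) z := by
    change f^[b - a] z = z
    rw [hz, ← Function.iterate_add_apply, Nat.sub_add_cancel hlt.le]
    exact he.symm
  have hpos : 0 < Function.minimalPeriod f z := hper.minimalPeriod_pos (by omega)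
  have hPz : ∀ n, P (f^[n] z) := by
    intro n; rw [hz, ← Function.iterate_add_apply]; exact hit _
  refine ⟨(List.range (Function.minimalPeriod f z)).map (fun n => f^[n] z), ⟨?_, ?_, ?_⟩, ?_⟩
  · intro hc
    have := congrArg List.length hc
    simp at this
    omega
  · refine List.Nodup.map_on ?_ List.nodup_range
    intro m hm n hn hmn
    rw [List.mem_range] at hm hn
    exact Function.iterate_injOn_Iio_minimalPeriod hm hn hmn
  · rintro ⟨i, hi⟩
    simp only [List.length_map, List.length_range] at hi
    simp only [List.get_eq_getElem, List.getElem_map, List.getElem_range, List.length_map,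
      List.length_range]
    rw [Function.iterate_mod_minimalPeriod_eq, Function.iterate_succ_apply']
    exact hfA _ (hPz i)
  · intro x hx
    rw [List.mem_map] at hx
    obtain ⟨n, _, rfl⟩ := hx
    exact hPz n

/-- Every dicycle contains a complete level and one more vertex. -/
theorem fr_dicycle_level (k g : ℕ) (hk : 0 < k) (hg : 4 ≤ g)
    (l : List (Option (Fin k × Fin (g - 1)))) (hl : (frieze k g hk hg).IsDicycle l) :
    ∃ m, 1 ≤ m ∧ m ≤ k ∧ (∀ q, q < g - 1 → ∃ x ∈ l, frLvl x = m ∧ frCol x = q) ∧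
      ∃ x ∈ l, frLvl x ≠ m := by
  have hs : ∀ x ∈ l, ∃ y ∈ l, FrR k g (frLvl x) (frCol x) (frLvl y) (frCol y) := by
    intro x hx
    obtain ⟨y, hy, h⟩ := dicycle_succ (frieze k g hk hg) l hl x hx
    exact ⟨y, hy, (fr_adj k g hk hg x y).1 h⟩
  have hp : ∀ x ∈ l, ∃ y ∈ l, FrR k g (frLvl y) (frCol y) (frLvl x) (frCol x) := by
    intro x hx
    obtain ⟨y, hy, h⟩ := dicycle_pred (frieze k g hk hg) l hl x hx
    exact ⟨y, hy, (fr_adj k g hk hg y x).1 h⟩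
  have hne : l.toFinset.Nonempty := by
    obtain ⟨x, hx⟩ := List.exists_mem_of_ne_nil l hl.1
    exact ⟨x, List.mem_toFinset.2 hx⟩
  obtain ⟨x, hx, hmax⟩ := Finset.exists_max_image l.toFinset frLvl hne
  simp only [List.mem_toFinset] at hx hmax
  obtain ⟨m, hm⟩ : ∃ m, m = frLvl x := ⟨_, rfl⟩
  rw [← hm] at hmax
  have hm1 : 1 ≤ m := by
    by_contra hc
    obtain ⟨y, hy, h⟩ := hs x hx
    have := hmax y hy
    unfold FrR at h
    have := fr_bounds x
    omega
  have hb := fr_bounds x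
  have up : ∀ q, q + 1 < g - 1 → (∃ x ∈ l, frLvl x = m ∧ frCol x = q) →
      ∃ x ∈ l, frLvl x = m ∧ frCol x = q + 1 := by
    rintro q hq ⟨x, hx, h1, h2⟩
    obtain ⟨y, hy, h⟩ := hs x hx
    have := hmax y hy
    unfold FrR at h
    exact ⟨y, hy, by omega⟩
  have down : ∀ q, (∃ x ∈ l, frLvl x = m ∧ frCol x = q + 1) →
      ∃ x ∈ l, frLvl x = m ∧ frCol x = q := by
    rintro q ⟨x, hx, h1, h2⟩
    obtain ⟨y, hy, h⟩ := hp x hx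
    have := hmax y hy
    unfold FrR at h
    exact ⟨y, hy, by omega⟩
  have zero : ∀ q, (∃ x ∈ l, frLvl x = m ∧ frCol x = q) →
      ∃ x ∈ l, frLvl x = m ∧ frCol x = 0 := by
    intro q
    induction q with
    | zero => exact id
    | succ q ih => exact fun h => ih (down q h)
  have all : ∀ q, q < g - 1 → ∃ x ∈ l, frLvl x = m ∧ frCol x = q := by
    intro q
    induction q with
    | zero => exact fun _ => zero _ ⟨x, hx, hm.symm, rfl⟩
    | succ q ih => exact fun h => up q h (ih (by omega))
  refine ⟨m, hm1, by omega, all, ?_⟩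
  obtain ⟨y, hy, h1, h2⟩ := all (g - 2) (by omega)
  obtain ⟨z, hz, h⟩ := hs y hy
  unfold FrR at h
  exact ⟨z, hz, by omega⟩

theorem fr_length_ge (k g : ℕ) (hk : 0 < k) (hg : 4 ≤ g)
    (l : List (Option (Fin k × Fin (g - 1)))) (hl : (frieze k g hk hg).IsDicycle l) :
    g ≤ l.length := by
  obtain ⟨m, _, _, hall, z, hz, hzm⟩ := fr_dicycle_level k g hk hg l hl
  have h1 : Finset.range (g - 1) ⊆ ((l.toFinset.erase z).filter (fun x => frLvl x = m)).image frCol := by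
    intro q hq
    obtain ⟨x, hx, h1, h2⟩ := hall q (Finset.mem_range.1 hq)
    refine Finset.mem_image.2 ⟨x, Finset.mem_filter.2 ⟨Finset.mem_erase.2 ⟨?_, List.mem_toFinset.2 hx⟩, h1⟩, h2⟩
    rintro rfl
    exact hzm h1
  have h2 := (Finset.card_le_card h1).trans (Finset.card_image_le.trans (Finset.card_filter_le _ _))
  rw [Finset.card_range, Finset.card_erase_of_mem (List.mem_toFinset.2 hz)] at h2
  have h3 := List.toFinset_card_le l
  have h4 : 0 < l.length := List.length_pos_of_mem hz
  omega

/-- The outer cycle spanning levels `a+1, …, b` contains a dicycle. -/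
theorem fr_outer (k g : ℕ) (hk : 0 < k) (hg : 4 ≤ g) (a b : ℕ) (hab : a < b) (hb : b ≤ k) :
    ∃ l, (frieze k g hk hg).IsDicycle l ∧ ∀ x ∈ l,
      (frLvl x = a ∧ frCol x = 1) ∨ (frLvl x = b ∧ frCol x = 1) ∨
      (a < frLvl x ∧ frLvl x ≤ b ∧ frCol x ≠ 1) := by
  obtain ⟨x0, h01, h02⟩ := fr_exists (k := k) (n := g - 1) (p := b) (q := 1) (by omega)
  refine exists_dicycle (frieze k g hk hg) (fun x => (frLvl x = a ∧ frCol x = 1) ∨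
    (frLvl x = b ∧ frCol x = 1) ∨ (a < frLvl x ∧ frLvl x ≤ b ∧ frCol x ≠ 1)) x0
    (Or.inr (Or.inl ⟨h01, h02⟩)) ?_
  intro x hx
  have hxb := fr_bounds x
  have step : ∀ p q, ((p = 0 ∧ q = 1) ∨ (1 ≤ p ∧ p ≤ k ∧ q < g - 1)) →
      ((p = a ∧ q = 1) ∨ (p = b ∧ q = 1) ∨ (a < p ∧ p ≤ b ∧ q ≠ 1)) →
      FrR k g (frLvl x) (frCol x) p q →
      ∃ y : Option (Fin k × Fin (g - 1)), ((frLvl y = a ∧ frCol y = 1) ∨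
    (frLvl y = b ∧ frCol y = 1) ∨ (a < frLvl y ∧ frLvl y ≤ b ∧ frCol y ≠ 1)) ∧
      (frieze k g hk hg).Adj x y := by
    intro p q h1 h2 h3
    obtain ⟨y, rfl, rfl⟩ := fr_exists h1
    exact ⟨y, h2, (fr_adj k g hk hg x y).2 h3⟩
  by_cases c1 : frLvl x = a ∧ frCol x = 1
  · exact step (a + 1) 0 (by omega) (by omega) (Or.inr (Or.inr (Or.inl (by omega))))
  by_cases c2 : frCol x = 0 ∧ frLvl x < b
  · exact step (frLvl x + 1) 0 (by omega) (by omega) (Or.inr (Or.inr (Or.inr (Or.inl (by omega)))))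
  by_cases c3 : frCol x < g - 2
  · exact step (frLvl x) (frCol x + 1) (by omega) (by omega) (Or.inl (by omega))
  by_cases c4 : frLvl x = a + 1
  · exact step a 1 (by omega) (by omega) (Or.inr (Or.inl (by omega)))
  · exact step (frLvl x - 1) 2 (by omega) (by omega)
      (Or.inr (Or.inr (Or.inr (Or.inr (by omega)))))

theorem fr_fvs_ge (k g : ℕ) (hk : 0 < k) (hg : 4 ≤ g)
    (S : Finset (Option (Fin k × Fin (g - 1)))) (hS : (frieze k g hk hg).IsFVS S) :
    k ≤ S.card := by
  classical
  have hit : ∀ a b, a < b → b ≤ k → ∃ x ∈ S, (frLvl x = a ∧ frCol x = 1) ∨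
      (frLvl x = b ∧ frCol x = 1) ∨ (a < frLvl x ∧ frLvl x ≤ b ∧ frCol x ≠ 1) := by
    intro a b hab hb
    obtain ⟨l, hl, h⟩ := fr_outer k g hk hg a b hab hb
    obtain ⟨x, hx, hxl⟩ := hS l hl
    exact ⟨x, hx, h x hxl⟩
  have csucc : ∀ m, (S.filter (fun x => frLvl x ≤ m + 1)).card =
      (S.filter (fun x => frLvl x ≤ m)).card + (S.filter (fun x => frLvl x = m + 1)).card := by
    intro m
    rw [← Finset.card_union_of_disjoint]
    · congr 1
      ext x
      simp only [Finset.mem_filter, Finset.mem_union]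
      constructor
      · rintro ⟨h, h'⟩
        rcases Nat.lt_or_ge m (frLvl x) with h2 | h2
        · exact Or.inr ⟨h, by omega⟩
        · exact Or.inl ⟨h, h2⟩
      · rintro (⟨h, h'⟩ | ⟨h, h'⟩)
        · exact ⟨h, by omega⟩
        · exact ⟨h, by omega⟩
    · rw [Finset.disjoint_left]
      intro x h1 h2
      simp only [Finset.mem_filter] at h1 h2
      omega
  have main : ∀ m, m ≤ k → m + 1 ≤ (S.filter (fun x => frLvl x ≤ m)).card ∨
      (m ≤ (S.filter (fun x => frLvl x ≤ m)).card ∧ ∃ a, a ≤ m ∧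
        (∀ x ∈ S, ¬ (frLvl x = a ∧ frCol x = 1)) ∧
        ∀ x ∈ S, ¬ (a < frLvl x ∧ frLvl x ≤ m ∧ frCol x ≠ 1)) := by
    intro m
    induction m with
    | zero =>
      intro _
      by_cases h : ∃ x ∈ S, frLvl x = 0 ∧ frCol x = 1
      · obtain ⟨x, hx, h1, _⟩ := h
        left
        exact Finset.card_pos.2 ⟨x, Finset.mem_filter.2 ⟨hx, by omega⟩⟩
      · right
        push Not at h
        refine ⟨Nat.zero_le _, 0, le_rfl, fun x hx hc => h x hx hc.1 hc.2, fun x hx hc => by omega⟩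
    | succ m ih =>
      intro hmk
      have ih := ih (by omega)
      have cs := csucc m
      by_cases hbm : ∃ x ∈ S, frLvl x = m + 1 ∧ frCol x = 1
      · obtain ⟨x, hx, hx1, hx2⟩ := hbm
        have c1 : 1 ≤ (S.filter (fun x => frLvl x = m + 1)).card :=
          Finset.card_pos.2 ⟨x, Finset.mem_filter.2 ⟨hx, hx1⟩⟩
        rcases ih with ih | ⟨ih, a, ha, ha1, ha2⟩
        · left; omega
        by_cases hA : ∃ y ∈ S, frLvl y = m + 1 ∧ frCol y ≠ 1
        · obtain ⟨y, hy, hy1, hy2⟩ := hA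
          left
          have c2 : 1 < (S.filter (fun x => frLvl x = m + 1)).card :=
            Finset.one_lt_card.2 ⟨x, Finset.mem_filter.2 ⟨hx, hx1⟩, y,
              Finset.mem_filter.2 ⟨hy, hy1⟩, by rintro rfl; exact hy2 hx2⟩
          omega
        · right
          push Not at hA
          refine ⟨by omega, a, by omega, ha1, ?_⟩
          intro y hy hc
          by_cases hl : frLvl y = m + 1
          · exact hc.2.2 (hA y hy hl)
          · exact ha2 y hy ⟨hc.1, by omega, hc.2.2⟩
      · right
        refine ⟨?_, m + 1, le_rfl, fun x hx hc => hbm ⟨x, hx, hc⟩, fun x hx hc => by omega⟩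
        rcases ih with ih | ⟨ih, a, ha, ha1, ha2⟩
        · omega
        obtain ⟨x, hx, h | h | h⟩ := hit a (m + 1) (by omega) hmk
        · exact absurd h (ha1 x hx)
        · exact absurd ⟨x, hx, h⟩ hbm
        · have hl : frLvl x = m + 1 := by
            by_contra hl
            exact ha2 x hx ⟨h.1, by omega, h.2.2⟩
          have c1 : 1 ≤ (S.filter (fun x => frLvl x = m + 1)).card :=
            Finset.card_pos.2 ⟨x, Finset.mem_filter.2 ⟨hx, hl⟩⟩
          omega
  have h1 := main k le_rfl
  have h2 := Finset.card_filter_le S (fun x => frLvl x ≤ k)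
  omega

theorem fr_fvs_le (k g : ℕ) (hk : 0 < k) (hg : 4 ≤ g) :
    ∃ S : Finset (Option (Fin k × Fin (g - 1))), (frieze k g hk hg).IsFVS S ∧ S.card = k := by
  classical
  refine ⟨Finset.univ.image (fun i : Fin k => some (i, ⟨0, by omega⟩)), ?_, ?_⟩
  · intro l hl
    obtain ⟨m, hm1, hm2, hall, _⟩ := fr_dicycle_level k g hk hg l hl
    obtain ⟨x, hx, h1, h2⟩ := hall 0 (by omega)
    refine ⟨x, ?_, hx⟩
    apply Finset.mem_image.2
    refine ⟨⟨m - 1, by omega⟩, Finset.mem_univ _, ?_⟩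
    refine (fr_ext _ x).2 ⟨?_, h2.symm⟩
    rw [h1]
    exact Nat.sub_add_cancel hm1
  · rw [Finset.card_image_of_injective, Finset.card_univ, Fintype.card_fin]
    intro i j h
    simpa using h

theorem fr_fvs_eq (k g : ℕ) (hk : 0 < k) (hg : 4 ≤ g) : (frieze k g hk hg).fvs = k := by
  unfold Digr.fvs
  apply le_antisymm
  · exact Nat.sInf_le (fr_fvs_le k g hk hg)
  · refine le_csInf ⟨k, fr_fvs_le k g hk hg⟩ ?_
    rintro n ⟨S, hS, rfl⟩
    exact fr_fvs_ge k g hk hg S hS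

theorem fr_card (k g : ℕ) (hk : 0 < k) (hg : 4 ≤ g) :
    Nat.card (frieze k g hk hg).V = k * (g - 1) + 1 := by
  change Nat.card (Option (Fin k × Fin (g - 1))) = _
  simp

theorem fr_digirth (k g : ℕ) (hk : 0 < k) (hg : 4 ≤ g) : (frieze k g hk hg).HasDigirth g := by
  classical
  refine ⟨?_, fr_length_ge k g hk hg⟩
  obtain ⟨l, hl, h⟩ := fr_outer k g hk hg 0 1 (by omega) hk
  refine ⟨l, hl, le_antisymm ?_ (fr_length_ge k g hk hg l hl)⟩
  have hn : l.Nodup := hl.2.1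
  rw [← List.toFinset_card_of_nodup hn]
  have : l.toFinset.card ≤ (Finset.range g).card := by
    apply Finset.card_le_card_of_injOn (fun x => if frLvl x = 0 then g - 1 else frCol x)
    · intro x hx
      have hb := fr_bounds x
      simp only [Finset.coe_range, Set.mem_Iio]
      split_ifs <;> omega
    · intro x hx y hy hxy
      have hx' := h x (List.mem_toFinset.1 hx)
      have hy' := h y (List.mem_toFinset.1 hy)
      have hbx := fr_bounds x
      have hby := fr_bounds y
      apply (fr_ext x y).2
      simp only at hxy
      split_ifs at hxy <;> omega
  simpa using this

/-- For every `k ≥ 1` and `g ≥ 4`, the frieze digraph `G_k` has digirth `g`,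
order `n_k = k(g−1)+1`, and `fvs(G_k) = k = (n_k − 1)/(g − 1)`. -/
theorem frieze_digirth_order_fvs (k g : ℕ) (hk : 1 ≤ k) (hg : 4 ≤ g) :
    (frieze k g hk hg).HasDigirth g ∧
    Nat.card (frieze k g hk hg).V = k * (g - 1) + 1 ∧
    (frieze k g hk hg).fvs = k ∧
    (frieze k g hk hg).fvs = (Nat.card (frieze k g hk hg).V - 1) / (g - 1) := by
  refine ⟨fr_digirth k g hk hg, fr_card k g hk hg, fr_fvs_eq k g hk hg, ?_⟩
  rw [fr_fvs_eq k g hk hg, fr_card k g hk hg, Nat.add_sub_cancel]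
  exact (Nat.mul_div_cancel k (by omega)).symm
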